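/- arXiv:2011.06818 — 8 statements merged into one kernel-verified Lean document; each statement's English description precedes it below -/
import Mathlib

section
/- Let ν > 0, ω ∈ ℝ, m ≥ 1, a = ω√ν, and let M, K be m×m real matrices. Let 𝒜 be the 4m×4m block matrix with block rows (M, 0, √ν K, aM), (0, M, −aM, √ν K), (√ν K, −aM, −M, 0), (aM, √ν K, 0, −M). Let G₁ = g₁ ⊗ I_m where g₁ has rows (1,0,0,a), (0,1,−a,0), (0,−a,−1,0), (a,0,0,−1); let G = (1/√(ν(1+νω²))) · (g ⊗ I_m) where g has rows (0, ων, √ν, 0), (−ων, 0, 0, √ν), (−√ν, 0, 0, −ων), (0, −√ν, ων, 0); let 𝓜 = I₄ ⊗ M, η = √ν/√(1+νω²), and 𝓚 = η · (I₄ ⊗ K). Then 𝒜 = G₁ · (𝓜 + G·𝓚). -/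
open Matrix
open scoped Kronecker

theorem stmt5 (ν ω : ℝ) (hν : 0 < ν) (m : ℕ) (hm : 1 ≤ m)
    (a η : ℝ) (ha : a = ω * Real.sqrt ν)
    (hη : η = Real.sqrt ν / Real.sqrt (1 + ν * ω ^ 2))
    (M K : Matrix (Fin m) (Fin m) ℝ)
    (𝒜 G₁ G 𝓜 𝓚 : Matrix (Fin 4 × Fin m) (Fin 4 × Fin m) ℝ)
    (h𝒜 : 𝒜 = (!![1, 0, 0, a; 0, 1, -a, 0; 0, -a, -1, 0; a, 0, 0, -1] :
          Matrix (Fin 4) (Fin 4) ℝ) ⊗ₖ M +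
        Real.sqrt ν • ((!![0, 0, 1, 0; 0, 0, 0, 1; 1, 0, 0, 0; 0, 1, 0, 0] :
          Matrix (Fin 4) (Fin 4) ℝ) ⊗ₖ K))
    (hG₁ : G₁ = (!![1, 0, 0, a; 0, 1, -a, 0; 0, -a, -1, 0; a, 0, 0, -1] :
        Matrix (Fin 4) (Fin 4) ℝ) ⊗ₖ (1 : Matrix (Fin m) (Fin m) ℝ))
    (hG : G = (1 / Real.sqrt (ν * (1 + ν * ω ^ 2))) •
      ((!![0, ω * ν, Real.sqrt ν, 0;
           -(ω * ν), 0, 0, Real.sqrt ν;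
           -(Real.sqrt ν), 0, 0, -(ω * ν);
           0, -(Real.sqrt ν), ω * ν, 0] : Matrix (Fin 4) (Fin 4) ℝ) ⊗ₖ
        (1 : Matrix (Fin m) (Fin m) ℝ)))
    (h𝓜 : 𝓜 = (1 : Matrix (Fin 4) (Fin 4) ℝ) ⊗ₖ M)
    (h𝓚 : 𝓚 = η • ((1 : Matrix (Fin 4) (Fin 4) ℝ) ⊗ₖ K)) :
    𝒜 = G₁ * (𝓜 + G * 𝓚) := by
  have hs : Real.sqrt ν * Real.sqrt ν = ν := Real.mul_self_sqrt hν.le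
  have ht : 0 < 1 + ν * ω ^ 2 := by positivity
  have hg : (!![1, 0, 0, a; 0, 1, -a, 0; 0, -a, -1, 0; a, 0, 0, -1] :
        Matrix (Fin 4) (Fin 4) ℝ) *
      !![0, ω * ν, Real.sqrt ν, 0;
         -(ω * ν), 0, 0, Real.sqrt ν;
         -(Real.sqrt ν), 0, 0, -(ω * ν);
         0, -(Real.sqrt ν), ω * ν, 0] =
      (Real.sqrt ν * (1 + ν * ω ^ 2)) •
        !![0, 0, 1, 0; 0, 0, 0, 1; 1, 0, 0, 0; 0, 1, 0, 0] := by
    subst ha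
    ext i j
    fin_cases i <;> fin_cases j <;> simp [Matrix.mul_apply, Fin.sum_univ_four] <;> grind
  have hc : 1 / Real.sqrt (ν * (1 + ν * ω ^ 2)) * η * (Real.sqrt ν * (1 + ν * ω ^ 2)) =
      Real.sqrt ν := by
    have hsν : Real.sqrt ν ≠ 0 := (Real.sqrt_pos.mpr hν).ne'
    have hst : Real.sqrt (1 + ν * ω ^ 2) ≠ 0 := (Real.sqrt_pos.mpr ht).ne'
    have htt := Real.mul_self_sqrt ht.le
    rw [hη, Real.sqrt_mul hν.le]
    field_simp
    linarith
  subst h𝒜 hG₁ hG h𝓜 h𝓚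
  rw [mul_add, smul_mul_smul_comm, mul_smul_comm, ← mul_kronecker_mul, ← mul_kronecker_mul,
    ← mul_kronecker_mul, mul_one, one_mul, mul_one, one_mul, one_mul, hg, smul_kronecker,
    smul_smul, hc]
end

section
/- Let ν > 0, ω ∈ ℝ, m ≥ 1, and α > 0. Let M be an m×m real symmetric positive definite matrix with eigenvalues μ₁, …, μ_m, let 𝓜 = I₄ ⊗ M, and let G = (1/√(ν(1+νω²))) · (g ⊗ I_m), where g has rows (0, ων, √ν, 0), (−ων, 0, 0, √ν), (−√ν, 0, 0, −ων), (0, −√ν, ων, 0). Let R_α = (α I_{4m} + G·𝓜) · (α I_{4m} + 𝓜)⁻¹. Then the operator norm of R_α induced by the Euclidean vector norm satisfies ‖R_α‖₂ = max over i = 1,…,m of √(α² + μᵢ²)/(α + μᵢ). -/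
open Matrix
open scoped Kronecker

section
open scoped Matrix.Norms.L2Operator

/-- Conjugation by a unitary matrix preserves the `ℓ²` operator norm. -/
lemma Matrix.l2_opNorm_conjStarAlgAut {n : Type*} [Fintype n] [DecidableEq n]
    (V : unitary (Matrix n n ℝ)) (A : Matrix n n ℝ) :
    ‖Unitary.conjStarAlgAut ℝ (Matrix n n ℝ) V A‖ = ‖A‖ := by
  rw [Unitary.conjStarAlgAut_apply, ← Unitary.coe_star, CStarRing.norm_mul_coe_unitary,
    CStarRing.norm_coe_unitary_mul]

/-- If `J` is a skew-adjoint complex structure commuting with a symmetric matrix `S` whose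
spectral decomposition has eigenvalues `d`, then `(α + J S) (α + S)⁻¹` has the `ℓ²` operator
norm of the diagonal matrix with entries `√(α² + dᵢ²) / (α + dᵢ)`. -/
lemma Matrix.norm_toEuclideanCLM_add_mul_mul_inv_of_skew {n : Type*} [Fintype n] [DecidableEq n]
    {α : ℝ} {d : n → ℝ} (hd : ∀ i, α + d i ≠ 0) (V : unitary (Matrix n n ℝ))
    {J S : Matrix n n ℝ} (hS : S = V * diagonal d * star (V : Matrix n n ℝ))
    (hJ : star J = -J) (hJJ : J * J = -1) (hJS : Commute J S) :
    ‖toEuclideanCLM (𝕜 := ℝ)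
        ((α • (1 : Matrix n n ℝ) + J * S) * (α • (1 : Matrix n n ℝ) + S)⁻¹)‖ =
      ‖fun i => √(α ^ 2 + d i ^ 2) / (α + d i)‖ := by
  rw [← Unitary.conjStarAlgAut_apply (S := ℝ)] at hS
  set φ := Unitary.conjStarAlgAut ℝ (Matrix n n ℝ) V
  have hα : α • (1 : Matrix n n ℝ) = diagonal fun _ => α := smul_one_eq_diagonal α
  have hSstar : star S = S := by
    rw [hS, ← map_star, star_eq_conjTranspose, diagonal_conjTranspose, star_trivial]
  have hshift : α • (1 : Matrix n n ℝ) + S = φ (diagonal fun i => α + d i) := by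
    rw [← diagonal_add, ← hα, map_add, map_smul, map_one, hS]
  have hinv : (α • (1 : Matrix n n ℝ) + S)⁻¹ = φ (diagonal fun i => (α + d i)⁻¹) := by
    refine inv_eq_right_inv ?_
    rw [hshift, ← map_mul, diagonal_mul_diagonal]
    simp [hd]
  have hnormal : star (α • (1 : Matrix n n ℝ) + J * S) * (α • (1 : Matrix n n ℝ) + J * S) =
      φ (diagonal fun i => α ^ 2 + d i ^ 2) := by
    have hSS : φ (diagonal fun i => α ^ 2 + d i ^ 2) = α ^ 2 • (1 : Matrix n n ℝ) + S * S := by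
      rw [← diagonal_add, ← smul_one_eq_diagonal, map_add, map_smul, map_one, hS, ← map_mul,
        diagonal_mul_diagonal]
      simp only [sq]
    have hJSJS : J * S * (J * S) = -(S * S) := by
      rw [hJS.symm.mul_mul_mul_comm, hJJ, neg_one_mul]
    rw [hSS, star_add, star_smul, star_one, star_mul, hSstar, hJ, star_trivial, mul_neg,
      ← hJS.eq, add_mul, mul_add, mul_add, neg_mul, neg_mul, hJSJS]
    simp only [smul_mul_assoc, mul_smul_comm, one_mul, mul_one, smul_smul, sq]
    abel
  rw [← cstar_norm_def, ← l2_opNorm_diagonal, ← mul_self_inj (norm_nonneg _) (norm_nonneg _),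
    ← CStarRing.norm_star_mul_self, ← CStarRing.norm_star_mul_self, star_mul, mul_assoc,
    ← mul_assoc (star (α • (1 : Matrix n n ℝ) + J * S)), hnormal, hinv, ← map_star, ← map_mul,
    ← map_mul, l2_opNorm_conjStarAlgAut]
  simp only [star_eq_conjTranspose, diagonal_conjTranspose, star_trivial, diagonal_mul_diagonal]
  congr 2
  funext i
  have hsq : √(α ^ 2 + d i ^ 2) * √(α ^ 2 + d i ^ 2) = α ^ 2 + d i ^ 2 :=
    Real.mul_self_sqrt (by positivity)
  rw [div_mul_div_comm, hsq]
  field_simp [hd i]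

end

/-- The spectral theorem for `I ⊗ M`: it is unitarily diagonalized, each eigenvalue of `M`
occurring once for every index of the identity block. -/
lemma Matrix.IsHermitian.exists_unitary_one_kronecker_eq {n : Type*} [Fintype n] [DecidableEq n]
    {M : Matrix n n ℝ} (hM : M.IsHermitian) (k : Type*) [Fintype k] [DecidableEq k] :
    ∃ V : unitary (Matrix (k × n) (k × n) ℝ), (1 : Matrix k k ℝ) ⊗ₖ M =
      V * (diagonal fun p : k × n => hM.eigenvalues p.2) *
        star (V : Matrix (k × n) (k × n) ℝ) := by
  refine ⟨⟨(1 : Matrix k k ℝ) ⊗ₖ (hM.eigenvectorUnitary : Matrix n n ℝ),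
    kronecker_mem_unitary (one_mem _) hM.eigenvectorUnitary.2⟩, ?_⟩
  have hdiag : (diagonal fun p : k × n => hM.eigenvalues p.2) =
      (1 : Matrix k k ℝ) ⊗ₖ diagonal hM.eigenvalues := by
    rw [← diagonal_one, diagonal_kronecker_diagonal]
    simp
  conv_lhs => rw [hM.spectral_theorem]
  simp only [hdiag, Unitary.conjStarAlgAut_apply, star_eq_conjTranspose,
    conjTranspose_kronecker, conjTranspose_one, ← mul_kronecker_mul, one_mul]
  rfl

lemma conjTranspose_quaternionic_skew (a s : ℝ) :
    (!![0, a, s, 0; -a, 0, 0, s; -s, 0, 0, -a; 0, -s, a, 0] : Matrix (Fin 4) (Fin 4) ℝ)ᴴ =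
      -!![0, a, s, 0; -a, 0, 0, s; -s, 0, 0, -a; 0, -s, a, 0] := by
  ext i j
  fin_cases i <;> fin_cases j <;> simp

lemma quaternionic_skew_mul_self (a s : ℝ) :
    (!![0, a, s, 0; -a, 0, 0, s; -s, 0, 0, -a; 0, -s, a, 0] : Matrix (Fin 4) (Fin 4) ℝ) *
      !![0, a, s, 0; -a, 0, 0, s; -s, 0, 0, -a; 0, -s, a, 0] =
      (-(a ^ 2 + s ^ 2)) • (1 : Matrix (Fin 4) (Fin 4) ℝ) := by
  ext i j
  fin_cases i <;> fin_cases j <;> simp [Matrix.mul_apply, Fin.sum_univ_four] <;> ring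

theorem stmt6 (ν ω : ℝ) (hν : 0 < ν) (m : ℕ) (hm : 1 ≤ m) (α : ℝ) (hα : 0 < α)
    (M : Matrix (Fin m) (Fin m) ℝ) (hM : M.PosDef)
    (G 𝓜 Rα : Matrix (Fin 4 × Fin m) (Fin 4 × Fin m) ℝ)
    (hG : G = (1 / Real.sqrt (ν * (1 + ν * ω ^ 2))) •
      ((!![0, ω * ν, Real.sqrt ν, 0;
           -(ω * ν), 0, 0, Real.sqrt ν;
           -(Real.sqrt ν), 0, 0, -(ω * ν);
           0, -(Real.sqrt ν), ω * ν, 0] : Matrix (Fin 4) (Fin 4) ℝ) ⊗ₖ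
        (1 : Matrix (Fin m) (Fin m) ℝ)))
    (h𝓜 : 𝓜 = (1 : Matrix (Fin 4) (Fin 4) ℝ) ⊗ₖ M)
    (hR : Rα = (α • (1 : Matrix (Fin 4 × Fin m) (Fin 4 × Fin m) ℝ) + G * 𝓜) *
        (α • (1 : Matrix (Fin 4 × Fin m) (Fin 4 × Fin m) ℝ) + 𝓜)⁻¹) :
    ‖Matrix.toEuclideanCLM (𝕜 := ℝ) Rα‖ =
      Finset.univ.sup' (Finset.univ_nonempty_iff.mpr ⟨⟨0, hm⟩⟩)
        (fun i : Fin m =>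
          Real.sqrt (α ^ 2 + hM.1.eigenvalues i ^ 2) / (α + hM.1.eigenvalues i)) := by
  have hpos : 0 < ν * (1 + ν * ω ^ 2) := by positivity
  have hnorm : (ω * ν) ^ 2 + √ν ^ 2 = ν * (1 + ν * ω ^ 2) := by
    rw [Real.sq_sqrt hν.le]
    ring
  have hGskew : star G = -G := by
    rw [hG, star_smul, star_trivial, star_eq_conjTranspose, conjTranspose_kronecker,
      conjTranspose_quaternionic_skew, conjTranspose_one, ← neg_one_smul ℝ (of _),
      smul_kronecker, smul_comm, neg_one_smul]
  have hGG : G * G = -1 := by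
    rw [hG, smul_mul_smul_comm, ← mul_kronecker_mul, quaternionic_skew_mul_self, hnorm,
      smul_kronecker, one_mul, one_kronecker_one, smul_smul, div_mul_div_comm,
      Real.mul_self_sqrt hpos.le, one_mul, mul_neg, one_div_mul_cancel hpos.ne', neg_one_smul]
  have hcomm : Commute G 𝓜 := by
    rw [hG, h𝓜]
    refine Commute.smul_left ?_ _
    rw [Commute, SemiconjBy, ← mul_kronecker_mul, ← mul_kronecker_mul]
    simp
  obtain ⟨V, hV⟩ := hM.1.exists_unitary_one_kronecker_eq (Fin 4)
  have hden (i : Fin m) : 0 < α + hM.1.eigenvalues i := add_pos hα (hM.eigenvalues_pos i)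
  rw [hR, norm_toEuclideanCLM_add_mul_mul_inv_of_skew (J := G) (S := 𝓜)
    (d := fun p : Fin 4 × Fin m => hM.1.eigenvalues p.2) (fun p => (hden p.2).ne') V
    (h𝓜.trans hV) hGskew hGG hcomm]
  have hnn (i : Fin m) :
      0 ≤ √(α ^ 2 + hM.1.eigenvalues i ^ 2) / (α + hM.1.eigenvalues i) :=
    div_nonneg (Real.sqrt_nonneg _) (hden i).le
  refine le_antisymm ?_ (Finset.sup'_le _ _ fun i _ => ?_)
  · have : Nonempty (Fin 4 × Fin m) := ⟨(0, ⟨0, hm⟩)⟩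
    refine (pi_norm_le_iff_of_nonempty _).mpr fun p => ?_
    rw [Real.norm_of_nonneg (hnn p.2)]
    exact Finset.le_sup' (fun i : Fin m =>
      √(α ^ 2 + hM.1.eigenvalues i ^ 2) / (α + hM.1.eigenvalues i)) (Finset.mem_univ p.2)
  · refine le_trans (Real.le_norm_self _) (norm_le_pi_norm (fun p : Fin 4 × Fin m =>
      √(α ^ 2 + hM.1.eigenvalues p.2 ^ 2) / (α + hM.1.eigenvalues p.2)) (0, i))
end

section
/- Let ν > 0, ω ∈ ℝ, m ≥ 1, α > 0, and η = √ν/√(1+νω²). Let K be an m×m real symmetric positive definite matrix with eigenvalues λ₁, …, λ_m, let 𝓚 = η · (I₄ ⊗ K), and let G = (1/√(ν(1+νω²))) · (g ⊗ I_m), where g has rows (0, ων, √ν, 0), (−ων, 0, 0, √ν), (−√ν, 0, 0, −ων), (0, −√ν, ων, 0). Let S_α = (α I_{4m} − G·𝓚) · (α I_{4m} + 𝓚)⁻¹. Then the operator norm of S_α induced by the Euclidean vector norm satisfies ‖S_α‖₂ = max over i = 1,…,m of √(α² + (η λᵢ)²)/(α + η λᵢ). -/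
open Matrix
open scoped Kronecker

open scoped Matrix.Norms.L2Operator in
/-- If `A = W * diagonal d * star W` with `W` unitary and `G` is a skew-symmetric orthogonal matrix
commuting with `A`, then `(α - G * A) * (α + A)⁻¹` has the norm of the diagonal matrix with entries
`√(α² + d i²) / (α + d i)`. -/
theorem l2_opNorm_skew_shift_mul_inv {n : Type*} [Fintype n] [DecidableEq n]
    {α : ℝ} {d : n → ℝ} (hd : ∀ i, 0 < α + d i)
    {G A W : Matrix n n ℝ} (hW : W ∈ unitary (Matrix n n ℝ))
    (hA : A = W * diagonal d * star W) (hskew : star G = -G) (horth : star G * G = 1)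
    (hcomm : G * A = A * G) :
    ‖(α • (1 : Matrix n n ℝ) - G * A) * (α • (1 : Matrix n n ℝ) + A)⁻¹‖ =
      ‖fun i => √(α ^ 2 + d i ^ 2) / (α + d i)‖ := by
  have hW₁ : star W * W = 1 := (Unitary.mem_iff.mp hW).1
  have hW₂ : W * star W = 1 := (Unitary.mem_iff.mp hW).2
  have conj_mul (a b : n → ℝ) : (W * diagonal a * star W) * (W * diagonal b * star W) =
      W * diagonal (fun i => a i * b i) * star W := by
    rw [← diagonal_mul_diagonal]
    calc _ = W * diagonal a * (star W * W) * diagonal b * star W := by simp only [mul_assoc]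
      _ = _ := by rw [hW₁, mul_one]; simp only [mul_assoc]
  have conj_add (a b : n → ℝ) : W * diagonal a * star W + W * diagonal b * star W =
      W * diagonal (fun i => a i + b i) * star W := by
    rw [← diagonal_add, mul_add, add_mul]
  have conj_const (c : ℝ) : c • (1 : Matrix n n ℝ) = W * diagonal (fun _ => c) * star W := by
    rw [← smul_one_eq_diagonal, mul_smul_comm, mul_one, smul_mul_assoc, hW₂]
  have conj_star (a : n → ℝ) : star (W * diagonal a * star W) = W * diagonal a * star W := by
    simp [star_mul, star_eq_conjTranspose, mul_assoc]
  have hinv : (α • (1 : Matrix n n ℝ) + A)⁻¹ =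
      W * diagonal (fun i => (α + d i)⁻¹) * star W := by
    apply Matrix.inv_eq_right_inv
    rw [hA, conj_const α, conj_add, conj_mul]
    simp only [mul_inv_cancel₀ (hd _).ne']
    rw [← conj_const, one_smul]
  have hAs : star A = A := by rw [hA, conj_star]
  have hnum : star (α • (1 : Matrix n n ℝ) - G * A) * (α • (1 : Matrix n n ℝ) - G * A) =
      W * diagonal (fun i => α * α + d i * d i) * star W := by
    have hGA : star (G * A) = -(G * A) := by rw [star_mul, hAs, hskew, mul_neg, hcomm]
    have hsq : (G * A) * (G * A) = -(A * A) := by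
      have hG : G * G = -1 := by rw [← horth, hskew, neg_mul, neg_neg]
      calc _ = G * (A * G) * A := by simp only [mul_assoc]
        _ = (G * G) * (A * A) := by rw [← hcomm]; simp only [mul_assoc]
        _ = _ := by rw [hG, neg_one_mul]
    rw [← conj_add, ← conj_mul d d, ← conj_mul (fun _ => α) (fun _ => α), ← conj_const, ← hA,
      star_sub, hGA, star_smul, star_one, star_trivial α, sub_neg_eq_add, add_mul, mul_sub, mul_sub,
      hsq]
    simp only [smul_mul_assoc, mul_smul_comm, one_mul, mul_one]
    abel
  have key : star ((α • (1 : Matrix n n ℝ) - G * A) * (α • (1 : Matrix n n ℝ) + A)⁻¹) *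
      ((α • (1 : Matrix n n ℝ) - G * A) * (α • (1 : Matrix n n ℝ) + A)⁻¹) =
      W * (star (diagonal fun i => √(α ^ 2 + d i ^ 2) / (α + d i)) *
        diagonal fun i => √(α ^ 2 + d i ^ 2) / (α + d i)) * star W := by
    rw [star_mul, mul_assoc, ← mul_assoc (star (_ - _)), hnum, hinv, conj_star, conj_mul, conj_mul,
      star_eq_conjTranspose (diagonal _), diagonal_conjTranspose,
      diagonal_mul_diagonal]
    congr 3
    funext i
    have hs := Real.mul_self_sqrt (by positivity : 0 ≤ α ^ 2 + d i ^ 2)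
    have := (hd i).ne'
    rw [star_trivial, div_mul_div_comm, hs]
    field_simp
  rw [← l2_opNorm_diagonal, ← mul_self_inj (norm_nonneg _) (norm_nonneg _),
    ← CStarRing.norm_star_mul_self, ← CStarRing.norm_star_mul_self, key,
    CStarRing.norm_mul_mem_unitary _ (Unitary.star_mem hW), CStarRing.norm_mem_unitary_mul _ hW]

theorem stmt7 (ν ω : ℝ) (hν : 0 < ν) (m : ℕ) (hm : 1 ≤ m) (α : ℝ) (hα : 0 < α)
    (η : ℝ) (hη : η = Real.sqrt ν / Real.sqrt (1 + ν * ω ^ 2))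
    (K : Matrix (Fin m) (Fin m) ℝ) (hK : K.PosDef)
    (G 𝓚 Sα : Matrix (Fin 4 × Fin m) (Fin 4 × Fin m) ℝ)
    (hG : G = (1 / Real.sqrt (ν * (1 + ν * ω ^ 2))) •
      ((!![0, ω * ν, Real.sqrt ν, 0;
           -(ω * ν), 0, 0, Real.sqrt ν;
           -(Real.sqrt ν), 0, 0, -(ω * ν);
           0, -(Real.sqrt ν), ω * ν, 0] : Matrix (Fin 4) (Fin 4) ℝ) ⊗ₖ
        (1 : Matrix (Fin m) (Fin m) ℝ)))
    (h𝓚 : 𝓚 = η • ((1 : Matrix (Fin 4) (Fin 4) ℝ) ⊗ₖ K))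
    (hS : Sα = (α • (1 : Matrix (Fin 4 × Fin m) (Fin 4 × Fin m) ℝ) - G * 𝓚) *
        (α • (1 : Matrix (Fin 4 × Fin m) (Fin 4 × Fin m) ℝ) + 𝓚)⁻¹) :
    ‖Matrix.toEuclideanCLM (𝕜 := ℝ) Sα‖ =
      Finset.univ.sup' (Finset.univ_nonempty_iff.mpr ⟨⟨0, hm⟩⟩)
        (fun i : Fin m =>
          Real.sqrt (α ^ 2 + (η * hK.1.eigenvalues i) ^ 2) /
            (α + η * hK.1.eigenvalues i)) := by
  have hηpos : 0 < η := by rw [hη]; positivity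
  have hpos (i : Fin m) : 0 < α + η * hK.1.eigenvalues i := by
    have := hK.eigenvalues_pos i
    positivity
  set g : Matrix (Fin 4) (Fin 4) ℝ := !![0, ω * ν, Real.sqrt ν, 0;
           -(ω * ν), 0, 0, Real.sqrt ν;
           -(Real.sqrt ν), 0, 0, -(ω * ν);
           0, -(Real.sqrt ν), ω * ν, 0] with hg
  have hgskew : gᴴ = -g := by
    ext i j
    fin_cases i <;> fin_cases j <;> simp [hg]
  have hgsq : gᴴ * g = (ν * (1 + ν * ω ^ 2)) • (1 : Matrix (Fin 4) (Fin 4) ℝ) := by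
    have hs := Real.mul_self_sqrt hν.le
    rw [hgskew]
    ext i j
    fin_cases i <;> fin_cases j <;> simp [hg, Matrix.mul_apply, Fin.sum_univ_four] <;>
      first | linear_combination hs | ring
  have hskew : star G = -G := by
    rw [star_eq_conjTranspose, hG, conjTranspose_smul, conjTranspose_kronecker, hgskew,
      conjTranspose_one, star_trivial, ← smul_neg]
    congr 1
    ext
    simp
  have horth : star G * G = 1 := by
    have hs := Real.mul_self_sqrt (by positivity : 0 ≤ ν * (1 + ν * ω ^ 2))
    rw [star_eq_conjTranspose, hG, conjTranspose_smul, conjTranspose_kronecker, conjTranspose_one,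
      star_trivial, smul_mul_smul_comm, ← mul_kronecker_mul, hgsq, one_mul, smul_kronecker,
      one_kronecker_one, smul_smul, one_div_mul_one_div, hs,
      one_div_mul_cancel (by positivity), one_smul]
  have hcomm : G * 𝓚 = 𝓚 * G := by
    rw [hG, h𝓚, smul_mul_smul_comm, smul_mul_smul_comm, ← mul_kronecker_mul, ← mul_kronecker_mul,
      one_mul, mul_one, one_mul, mul_one, mul_comm η]
  set U : Matrix (Fin m) (Fin m) ℝ := hK.1.eigenvectorUnitary.1
  have hUmem : U ∈ unitary (Matrix (Fin m) (Fin m) ℝ) := hK.1.eigenvectorUnitary.2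
  have hW : (1 : Matrix (Fin 4) (Fin 4) ℝ) ⊗ₖ U ∈
      unitary (Matrix (Fin 4 × Fin m) (Fin 4 × Fin m) ℝ) :=
    kronecker_mem_unitary (one_mem _) hUmem
  have hKU : K = U * diagonal hK.1.eigenvalues * star U := by
    simpa [Unitary.conjStarAlgAut_apply] using hK.1.spectral_theorem
  have hdiag : 𝓚 = (1 : Matrix (Fin 4) (Fin 4) ℝ) ⊗ₖ U *
      diagonal (fun p : Fin 4 × Fin m => η * hK.1.eigenvalues p.2) *
      star ((1 : Matrix (Fin 4) (Fin 4) ℝ) ⊗ₖ U) := by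
    have hD : diagonal (fun p : Fin 4 × Fin m => η * hK.1.eigenvalues p.2) =
        η • ((1 : Matrix (Fin 4) (Fin 4) ℝ) ⊗ₖ diagonal hK.1.eigenvalues) := by
      rw [← diagonal_one, diagonal_kronecker_diagonal, ← diagonal_smul]
      simp [Pi.smul_def]
    rw [hD, star_eq_conjTranspose, conjTranspose_kronecker, mul_smul_comm, smul_mul_assoc,
      ← mul_kronecker_mul, ← mul_kronecker_mul, conjTranspose_one, one_mul, one_mul,
      ← star_eq_conjTranspose, ← hKU, h𝓚]
  have hnorm := l2_opNorm_skew_shift_mul_inv (fun p : Fin 4 × Fin m => hpos p.2) hW hdiag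
    hskew horth hcomm
  rw [← hS] at hnorm
  refine hnorm.trans (le_antisymm ?_ ?_)
  · have : Nonempty (Fin m) := ⟨⟨0, hm⟩⟩
    refine (pi_norm_le_iff_of_nonempty _).mpr fun p => ?_
    rw [Real.norm_of_nonneg (div_nonneg (Real.sqrt_nonneg _) (hpos p.2).le)]
    exact Finset.le_sup' (fun i : Fin m =>
      √(α ^ 2 + (η * hK.1.eigenvalues i) ^ 2) / (α + η * hK.1.eigenvalues i))
      (Finset.mem_univ p.2)
  · refine Finset.sup'_le _ _ fun i _ => (le_abs_self _).trans ?_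
    exact norm_le_pi_norm (fun p : Fin 4 × Fin m =>
      √(α ^ 2 + (η * hK.1.eigenvalues p.2) ^ 2) / (α + η * hK.1.eigenvalues p.2)) (0, i)
end

section
/- Let a, b be real numbers with 0 < a ≤ b, and for α > 0 define ζ(α) = max( √(α² + a²)/(α + a), √(α² + b²)/(α + b) ). Then the choice α* = √(a·b) minimizes ζ over (0,∞): for every α > 0, ζ(√(a·b)) ≤ ζ(α). -/
/-- Comparison of `√(s² + x²) / (s + x)` for two pairs of positive reals. -/
lemma sqrt_sq_add_sq_div_add_le {s x α y : ℝ} (hs : 0 < s) (hx : 0 < x) (hα : 0 < α)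
    (hy : 0 < y) (h : 0 ≤ (s * α - x * y) * (x * α - s * y)) :
    Real.sqrt (s ^ 2 + x ^ 2) / (s + x) ≤ Real.sqrt (α ^ 2 + y ^ 2) / (α + y) := by
  have hsx : 0 < s + x := by positivity
  have hαy : 0 < α + y := by positivity
  rw [div_le_div_iff₀ hsx hαy]
  refine (sq_le_sq₀ (by positivity) (by positivity)).1 ?_
  rw [mul_pow, mul_pow, Real.sq_sqrt (by positivity), Real.sq_sqrt (by positivity)]
  nlinarith

theorem stmt12 (a b : ℝ) (ha : 0 < a) (hab : a ≤ b)
    (ζ : ℝ → ℝ)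
    (hζ : ∀ α : ℝ, ζ α = max (Real.sqrt (α ^ 2 + a ^ 2) / (α + a))
        (Real.sqrt (α ^ 2 + b ^ 2) / (α + b))) :
    ∀ α : ℝ, 0 < α → ζ (Real.sqrt (a * b)) ≤ ζ α := by
  intro α hα
  have hb : 0 < b := ha.trans_le hab
  rw [hζ, hζ]
  have hs : 0 < Real.sqrt (a * b) := Real.sqrt_pos.2 (mul_pos ha hb)
  have hsq : Real.sqrt (a * b) ^ 2 = a * b := Real.sq_sqrt (mul_pos ha hb).le
  set s := Real.sqrt (a * b)
  have has : a ≤ s := by nlinarith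
  have hsb : s ≤ b := by nlinarith
  rcases le_total s α with h | h
  · refine le_max_of_le_left (max_le ?_ ?_) <;>
      refine sqrt_sq_add_sq_div_add_le hs ‹_› hα ha (mul_nonneg ?_ ?_) <;> nlinarith
  · refine le_max_of_le_right (max_le ?_ ?_) <;>
      refine sqrt_sq_add_sq_div_add_le hs ‹_› hα hb (mul_nonneg_of_nonpos_of_nonpos ?_ ?_) <;>
      nlinarith
end

section
/- Let ν > 0, ω ∈ ℝ, m ≥ 1, and η = √ν/√(1+νω²). Let M and K be m×m real matrices with K symmetric. Let 𝓜 = I₄ ⊗ M, 𝓚 = η · (I₄ ⊗ K), G = (1/√(ν(1+νω²))) · (g ⊗ I_m), where g has rows (0, ων, √ν, 0), (−ων, 0, 0, √ν), (−√ν, 0, 0, −ων), (0, −√ν, ων, 0), and set 𝓑 = 𝓜 + G·𝓚. Then 𝓑ᵀ + 𝓑 = 2·𝓜, provided M is symmetric. -/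
open Matrix
open scoped Kronecker

/-- The Kronecker product of a skew-symmetric and a symmetric matrix is skew-symmetric. -/
theorem transpose_kronecker_of_skew_of_symm {R m n : Type*} [CommRing R]
    {A : Matrix m m R} {B : Matrix n n R} (hA : Aᵀ = -A) (hB : Bᵀ = B) :
    (A ⊗ₖ B)ᵀ = -(A ⊗ₖ B) := by
  rw [← kroneckerMap_transpose, hA, hB]
  ext i j
  simp [kroneckerMap_apply]

/-- The Kronecker product of the identity and a symmetric matrix is symmetric. -/
theorem transpose_one_kronecker_of_symm {R m n : Type*} [CommRing R] [DecidableEq m]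
    {B : Matrix n n R} (hB : Bᵀ = B) :
    ((1 : Matrix m m R) ⊗ₖ B)ᵀ = 1 ⊗ₖ B := by
  rw [← kroneckerMap_transpose, transpose_one, hB]

theorem skew_coupling_transpose (a s : ℝ) :
    (!![0, a, s, 0; -a, 0, 0, s; -s, 0, 0, -a; 0, -s, a, 0] : Matrix (Fin 4) (Fin 4) ℝ)ᵀ =
      -!![0, a, s, 0; -a, 0, 0, s; -s, 0, 0, -a; 0, -s, a, 0] := by
  ext i j
  fin_cases i <;> fin_cases j <;> simp

theorem stmt13 (ν ω : ℝ) (hν : 0 < ν) (m : ℕ) (hm : 1 ≤ m)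
    (η : ℝ) (hη : η = Real.sqrt ν / Real.sqrt (1 + ν * ω ^ 2))
    (M K : Matrix (Fin m) (Fin m) ℝ) (hM : Mᵀ = M) (hK : Kᵀ = K)
    (G 𝓜 𝓚 𝓑 : Matrix (Fin 4 × Fin m) (Fin 4 × Fin m) ℝ)
    (hG : G = (1 / Real.sqrt (ν * (1 + ν * ω ^ 2))) •
      ((!![0, ω * ν, Real.sqrt ν, 0;
           -(ω * ν), 0, 0, Real.sqrt ν;
           -(Real.sqrt ν), 0, 0, -(ω * ν);
           0, -(Real.sqrt ν), ω * ν, 0] : Matrix (Fin 4) (Fin 4) ℝ) ⊗ₖ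
        (1 : Matrix (Fin m) (Fin m) ℝ)))
    (h𝓜 : 𝓜 = (1 : Matrix (Fin 4) (Fin 4) ℝ) ⊗ₖ M)
    (h𝓚 : 𝓚 = η • ((1 : Matrix (Fin 4) (Fin 4) ℝ) ⊗ₖ K))
    (h𝓑 : 𝓑 = 𝓜 + G * 𝓚) :
    𝓑ᵀ + 𝓑 = (2 : ℝ) • 𝓜 := by
  have hGK := transpose_kronecker_of_skew_of_symm
    (skew_coupling_transpose (ω * ν) (Real.sqrt ν)) hK
  have hMt := transpose_one_kronecker_of_symm (m := Fin 4) hM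
  rw [h𝓑, hG, h𝓚, h𝓜, smul_mul_smul_comm, ← mul_kronecker_mul, mul_one, one_mul,
    transpose_add, transpose_smul, hGK, hMt, smul_neg, two_smul]
  abel
end

section
/- Let ν > 0, ω ∈ ℝ, m ≥ 1, and η = √ν/√(1+νω²). Let M be an m×m real symmetric positive definite matrix and K an m×m real symmetric matrix. Let 𝓜 = I₄ ⊗ M, 𝓚 = η · (I₄ ⊗ K), G = (1/√(ν(1+νω²))) · (g ⊗ I_m), where g has rows (0, ων, √ν, 0), (−ων, 0, 0, √ν), (−√ν, 0, 0, −ων), (0, −√ν, ων, 0), and set 𝓑 = 𝓜 + G·𝓚. Then 𝓑 is positive real: for every nonzero real vector x ∈ ℝ^{4m}, xᵀ 𝓑 x > 0. -/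
open Matrix
open scoped Kronecker

/-- The quadratic form of a skew-symmetric real matrix vanishes. -/
theorem dotProduct_mulVec_self_eq_zero_of_transpose_eq_neg {n : Type*} [Fintype n]
    {S : Matrix n n ℝ} (hS : Sᵀ = -S) (x : n → ℝ) : x ⬝ᵥ (S *ᵥ x) = 0 := by
  have h : x ⬝ᵥ (S *ᵥ x) = -(x ⬝ᵥ (S *ᵥ x)) := by
    conv_lhs => rw [dotProduct_mulVec, ← mulVec_transpose, hS, neg_mulVec, neg_dotProduct,
      dotProduct_comm]
  linarith

theorem stmt14 (ν ω : ℝ) (hν : 0 < ν) (m : ℕ) (hm : 1 ≤ m)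
    (η : ℝ) (hη : η = Real.sqrt ν / Real.sqrt (1 + ν * ω ^ 2))
    (M K : Matrix (Fin m) (Fin m) ℝ) (hM : M.PosDef) (hK : Kᵀ = K)
    (G 𝓜 𝓚 𝓑 : Matrix (Fin 4 × Fin m) (Fin 4 × Fin m) ℝ)
    (hG : G = (1 / Real.sqrt (ν * (1 + ν * ω ^ 2))) •
      ((!![0, ω * ν, Real.sqrt ν, 0;
           -(ω * ν), 0, 0, Real.sqrt ν;
           -(Real.sqrt ν), 0, 0, -(ω * ν);
           0, -(Real.sqrt ν), ω * ν, 0] : Matrix (Fin 4) (Fin 4) ℝ) ⊗ₖ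
        (1 : Matrix (Fin m) (Fin m) ℝ)))
    (h𝓜 : 𝓜 = (1 : Matrix (Fin 4) (Fin 4) ℝ) ⊗ₖ M)
    (h𝓚 : 𝓚 = η • ((1 : Matrix (Fin 4) (Fin 4) ℝ) ⊗ₖ K))
    (h𝓑 : 𝓑 = 𝓜 + G * 𝓚) :
    ∀ x : Fin 4 × Fin m → ℝ, x ≠ 0 → 0 < x ⬝ᵥ (𝓑 *ᵥ x) := by
  intro x hx
  subst h𝓜 h𝓑
  rw [add_mulVec, dotProduct_add,
    dotProduct_mulVec_self_eq_zero_of_transpose_eq_neg (S := G * 𝓚), add_zero]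
  · simpa using (PosDef.one.kronecker hM).dotProduct_mulVec_pos hx
  · rw [hG, h𝓚, smul_mul, Matrix.mul_smul, ← mul_kronecker_mul, Matrix.mul_one, Matrix.one_mul,
      transpose_smul, transpose_smul, ← smul_neg, ← smul_neg]
    congr 2
    rw [← kroneckerMap_transpose, hK]
    ext ⟨i, k⟩ ⟨j, l⟩
    fin_cases i <;> fin_cases j <;> simp
end

section
/- Let ν > 0, ω ∈ ℝ, m ≥ 1, η = √ν/√(1+νω²), and let α be a nonzero real number. Let M and K be arbitrary m×m real matrices, 𝓜 = I₄ ⊗ M, 𝓚 = η · (I₄ ⊗ K), and G = (1/√(ν(1+νω²))) · (g ⊗ I_m), where g has rows (0, ων, √ν, 0), (−ων, 0, 0, √ν), (−√ν, 0, 0, −ων), (0, −√ν, ων, 0). Define, with I = I_{4m}, 𝓟_α = α⁻¹ · (½(I − G)) · (α I + 𝓜) · G · (α I + 𝓚) and 𝓠_α = α⁻¹ · (½(I − G)) · (α G − 𝓜) · (α I − G·𝓚). Then 𝓟_α − 𝓠_α = 𝓜 + G·𝓚. (Here ½(I − G) = (I + G)⁻¹, since (I+G)(I−G) = 2I.) 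-/
open Matrix
open scoped Kronecker

/-- The splitting identity behind the preconditioner, in any algebra: it only needs `G * G = -1`
and that `G` commutes with `M`. -/
theorem splitting_sub_eq {A : Type*} [Ring A] [Algebra ℝ A] {α : ℝ} (hα : α ≠ 0) {G M : A}
    (hG : G * G = -1) (hGM : Commute G M) (K : A) :
    α⁻¹ • (((2 : ℝ)⁻¹ • (1 - G)) * (α • (1 : A) + M) * G * (α • (1 : A) + K)) -
      α⁻¹ • (((2 : ℝ)⁻¹ • (1 - G)) * (α • G - M) * (α • (1 : A) - G * K)) = M + G * K := by
  have hGG (X : A) : G * (G * X) = -X := by rw [← mul_assoc, hG, neg_one_mul]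
  have hinner : (α • (1 : A) + M) * G * (α • (1 : A) + K) - (α • G - M) * (α • (1 : A) - G * K) =
      α • ((1 + G) * (M + G * K)) := by
    simp only [add_mul, mul_add, sub_mul, mul_sub, smul_mul_assoc, mul_smul_comm, one_mul, mul_one,
      mul_assoc, hGG, ← hGM.eq, hGM.symm.left_comm K, smul_add, smul_sub, smul_neg]
    abel
  have hinv : (1 - G) * (1 + G) = (2 : ℝ) • (1 : A) := by
    rw [sub_mul, mul_add, mul_add, hG, two_smul, mul_one, one_mul, mul_one]
    abel
  rw [← smul_sub, mul_assoc, mul_assoc, mul_assoc, ← mul_sub, ← mul_assoc (α • (1 : A) + M),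
    hinner, mul_smul_comm, inv_smul_smul₀ hα, smul_mul_assoc, ← mul_assoc, hinv, smul_mul_assoc,
    one_mul, inv_smul_smul₀ two_ne_zero]

theorem quaternionic_mul_self (a b : ℝ) :
    (!![0, a, b, 0; -a, 0, 0, b; -b, 0, 0, -a; 0, -b, a, 0] : Matrix (Fin 4) (Fin 4) ℝ) *
      !![0, a, b, 0; -a, 0, 0, b; -b, 0, 0, -a; 0, -b, a, 0] =
      (-(a ^ 2 + b ^ 2)) • (1 : Matrix (Fin 4) (Fin 4) ℝ) := by
  ext i j
  fin_cases i <;> fin_cases j <;> simp [Matrix.mul_apply, Fin.sum_univ_four] <;> ring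

theorem stmt15 (ν ω : ℝ) (hν : 0 < ν) (m : ℕ) (hm : 1 ≤ m)
    (η : ℝ) (hη : η = Real.sqrt ν / Real.sqrt (1 + ν * ω ^ 2))
    (α : ℝ) (hα : α ≠ 0)
    (M K : Matrix (Fin m) (Fin m) ℝ)
    (G 𝓜 𝓚 𝓟α 𝓠α : Matrix (Fin 4 × Fin m) (Fin 4 × Fin m) ℝ)
    (hG : G = (1 / Real.sqrt (ν * (1 + ν * ω ^ 2))) •
      ((!![0, ω * ν, Real.sqrt ν, 0;
           -(ω * ν), 0, 0, Real.sqrt ν;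
           -(Real.sqrt ν), 0, 0, -(ω * ν);
           0, -(Real.sqrt ν), ω * ν, 0] : Matrix (Fin 4) (Fin 4) ℝ) ⊗ₖ
        (1 : Matrix (Fin m) (Fin m) ℝ)))
    (h𝓜 : 𝓜 = (1 : Matrix (Fin 4) (Fin 4) ℝ) ⊗ₖ M)
    (h𝓚 : 𝓚 = η • ((1 : Matrix (Fin 4) (Fin 4) ℝ) ⊗ₖ K))
    (h𝓟 : 𝓟α = α⁻¹ •
        (((2 : ℝ)⁻¹ • ((1 : Matrix (Fin 4 × Fin m) (Fin 4 × Fin m) ℝ) - G)) *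
          (α • (1 : Matrix (Fin 4 × Fin m) (Fin 4 × Fin m) ℝ) + 𝓜) * G *
          (α • (1 : Matrix (Fin 4 × Fin m) (Fin 4 × Fin m) ℝ) + 𝓚)))
    (h𝓠 : 𝓠α = α⁻¹ •
        (((2 : ℝ)⁻¹ • ((1 : Matrix (Fin 4 × Fin m) (Fin 4 × Fin m) ℝ) - G)) *
          (α • G - 𝓜) *
          (α • (1 : Matrix (Fin 4 × Fin m) (Fin 4 × Fin m) ℝ) - G * 𝓚))) :
    𝓟α - 𝓠α = 𝓜 + G * 𝓚 := by
  have hpos : 0 < ν * (1 + ν * ω ^ 2) := by positivity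
  have hGG : G * G = -1 := by
    rw [hG, smul_mul_smul_comm, ← Matrix.mul_kronecker_mul, quaternionic_mul_self,
      Matrix.smul_kronecker, mul_one, Matrix.one_kronecker_one, smul_smul, div_mul_div_comm,
      Real.mul_self_sqrt hpos.le, Real.sq_sqrt hν.le]
    have hscalar : 1 * 1 / (ν * (1 + ν * ω ^ 2)) * -((ω * ν) ^ 2 + ν) = -1 := by
      field_simp
      ring
    rw [hscalar, neg_one_smul]
  have hGM : Commute G 𝓜 := by
    rw [hG, h𝓜]
    refine Commute.smul_left ?_ _
    rw [Commute, SemiconjBy, ← Matrix.mul_kronecker_mul, ← Matrix.mul_kronecker_mul]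
    simp only [mul_one, one_mul]
  rw [h𝓟, h𝓠]
  exact splitting_sub_eq hα hGG hGM 𝓚
end

section
/- Let ν > 0, ω ∈ ℝ, m ≥ 1, α > 0, and η = √ν/√(1+νω²). Let M and K be m×m real symmetric positive definite matrices, 𝓜 = I₄ ⊗ M, 𝓚 = η · (I₄ ⊗ K), and G = (1/√(ν(1+νω²))) · (g ⊗ I_m), where g has rows (0, ων, √ν, 0), (−ων, 0, 0, √ν), (−√ν, 0, 0, −ων), (0, −√ν, ων, 0). With I = I_{4m}, set 𝓑 = 𝓜 + G·𝓚, T_α = (α I + 𝓚)⁻¹ (α I + G·𝓜) (α I + 𝓜)⁻¹ (α I − G·𝓚), and 𝓟_α = α⁻¹ · (½(I − G)) · (α I + 𝓜) · G · (α I + 𝓚). Then 𝓟_α is invertible and 𝓟_α⁻¹ · 𝓑 = I − T_α. -/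
open Matrix
open scoped Kronecker

namespace Matrix

/-- Splitting identity behind an alternating-direction preconditioner: if `G` commutes with `M`
and `G * G = -1`, then the preconditioner is invertible and the preconditioned matrix is the
identity minus the iteration matrix. -/
theorem isUnit_and_inv_mul_eq_one_sub_of_mul_self_eq_neg_one {n : Type*} [Fintype n]
    [DecidableEq n] {G M K : Matrix n n ℝ} {α : ℝ} (hα : α ≠ 0)
    (hGM : M * G = G * M) (hGG : G * G = -1)
    (hA : IsUnit (α • (1 : Matrix n n ℝ) + M)) (hC : IsUnit (α • (1 : Matrix n n ℝ) + K)) :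
    IsUnit (α⁻¹ • (((2 : ℝ)⁻¹ • (1 - G)) * (α • 1 + M) * G * (α • 1 + K))) ∧
      (α⁻¹ • (((2 : ℝ)⁻¹ • (1 - G)) * (α • 1 + M) * G * (α • 1 + K)))⁻¹ * (M + G * K) =
        1 - (α • 1 + K)⁻¹ * (α • 1 + G * M) * (α • 1 + M)⁻¹ * (α • 1 - G * K) := by
  have hG : IsUnit G := by
    refine IsUnit.of_mul_eq_one (-G) ?_
    rw [mul_neg, hGG, neg_neg]
  have hH : IsUnit ((2 : ℝ)⁻¹ • (1 - G)) := by
    refine IsUnit.of_mul_eq_one (1 + G) ?_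
    simp only [smul_mul_assoc, mul_add, sub_mul, one_mul, mul_one, hGG]
    module
  have hP : IsUnit (α⁻¹ • (((2 : ℝ)⁻¹ • (1 - G)) * (α • 1 + M) * G * (α • 1 + K))) :=
    (((hH.mul hA).mul hG).mul hC).smul (Units.mk0 α⁻¹ (inv_ne_zero hα))
  refine ⟨hP, ?_⟩
  set A := α • (1 : Matrix n n ℝ) + M with hAdef
  set C := α • (1 : Matrix n n ℝ) + K with hCdef
  set P := α⁻¹ • (((2 : ℝ)⁻¹ • (1 - G)) * A * G * C) with hPdef
  have hM (X : Matrix n n ℝ) : M * (G * X) = G * (M * X) := by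
    rw [← mul_assoc, hGM, mul_assoc]
  have hGX (X : Matrix n n ℝ) : G * (G * X) = -X := by
    rw [← mul_assoc, hGG, neg_one_mul]
  have hcomm : A * G * (α • 1 + G * M) = G * (α • 1 + G * M) * A := by
    simp only [hAdef, add_mul, mul_add, smul_mul_assoc, mul_smul_comm, one_mul, mul_one,
      mul_assoc, hGM, hM]
    module
  have hPT : P * (C⁻¹ * (α • 1 + G * M) * A⁻¹ * (α • 1 - G * K)) =
      α⁻¹ • (((2 : ℝ)⁻¹ • (1 - G)) * (G * (α • 1 + G * M) * (α • 1 - G * K))) := by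
    have hCdet := (isUnit_iff_isUnit_det C).mp hC
    have hAdet := (isUnit_iff_isUnit_det A).mp hA
    calc P * (C⁻¹ * (α • 1 + G * M) * A⁻¹ * (α • 1 - G * K))
        = α⁻¹ • (((2 : ℝ)⁻¹ • (1 - G)) * (A * G * (C * C⁻¹) * (α • 1 + G * M)) * A⁻¹ *
            (α • 1 - G * K)) := by
          rw [hPdef, smul_mul_assoc]
          simp only [mul_assoc]
      _ = α⁻¹ • (((2 : ℝ)⁻¹ • (1 - G)) * (G * (α • 1 + G * M) * (A * A⁻¹) *
            (α • 1 - G * K))) := by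
          rw [mul_nonsing_inv _ hCdet, mul_one, hcomm]
          simp only [mul_assoc]
      _ = _ := by rw [mul_nonsing_inv _ hAdet, mul_one]
  have key : P * (1 - C⁻¹ * (α • 1 + G * M) * A⁻¹ * (α • 1 - G * K)) = M + G * K := by
    rw [mul_sub, mul_one, hPT, hPdef, hAdef, hCdef]
    simp only [add_mul, mul_add, sub_mul, mul_sub, smul_mul_assoc, mul_smul_comm, one_mul,
      mul_one, mul_assoc, hGM, hM, hGX, hGG, mul_neg, neg_mul]
    match_scalars <;> field_simp <;> ring
  rw [← key, nonsing_inv_mul_cancel_left _ _ ((isUnit_iff_isUnit_det P).mp hP)]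

theorem kronecker_skew_mul_self {m : Type*} [Fintype m] [DecidableEq m] {c a s : ℝ}
    (h : c ^ 2 * (a ^ 2 + s ^ 2) = 1) :
    (c • (!![0, a, s, 0; -a, 0, 0, s; -s, 0, 0, -a; 0, -s, a, 0] ⊗ₖ (1 : Matrix m m ℝ))) *
      (c • (!![0, a, s, 0; -a, 0, 0, s; -s, 0, 0, -a; 0, -s, a, 0] ⊗ₖ (1 : Matrix m m ℝ))) =
      -1 := by
  have hg : (!![0, a, s, 0; -a, 0, 0, s; -s, 0, 0, -a; 0, -s, a, 0] : Matrix (Fin 4) (Fin 4) ℝ) *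
      !![0, a, s, 0; -a, 0, 0, s; -s, 0, 0, -a; 0, -s, a, 0] = (-(a ^ 2 + s ^ 2)) • 1 := by
    ext i j
    fin_cases i <;> fin_cases j <;> simp [Matrix.mul_apply, Fin.sum_univ_four] <;> ring
  rw [smul_mul_assoc, mul_smul_comm, ← mul_kronecker_mul, hg, mul_one, smul_kronecker,
    one_kronecker_one, smul_smul, smul_smul,
    show c * c * -(a ^ 2 + s ^ 2) = -1 by linear_combination -h, neg_one_smul]

theorem PosDef.isUnit_smul_one_add_smul_kronecker {l m : Type*} [Fintype l] [DecidableEq l]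
    [Fintype m] [DecidableEq m] {A : Matrix m m ℝ} (hA : A.PosDef) {α c : ℝ} (hα : 0 < α)
    (hc : 0 < c) :
    IsUnit (α • (1 : Matrix (l × m) (l × m) ℝ) + c • ((1 : Matrix l l ℝ) ⊗ₖ A)) :=
  ((PosDef.one.smul hα).add ((PosDef.one.kronecker hA).smul hc)).isUnit

end Matrix

theorem stmt16 (ν ω : ℝ) (hν : 0 < ν) (m : ℕ) (hm : 1 ≤ m)
    (η : ℝ) (hη : η = Real.sqrt ν / Real.sqrt (1 + ν * ω ^ 2))
    (α : ℝ) (hα : 0 < α)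
    (M K : Matrix (Fin m) (Fin m) ℝ) (hM : M.PosDef) (hK : K.PosDef)
    (G 𝓜 𝓚 𝓑 Tα 𝓟α : Matrix (Fin 4 × Fin m) (Fin 4 × Fin m) ℝ)
    (hG : G = (1 / Real.sqrt (ν * (1 + ν * ω ^ 2))) •
      ((!![0, ω * ν, Real.sqrt ν, 0;
           -(ω * ν), 0, 0, Real.sqrt ν;
           -(Real.sqrt ν), 0, 0, -(ω * ν);
           0, -(Real.sqrt ν), ω * ν, 0] : Matrix (Fin 4) (Fin 4) ℝ) ⊗ₖ
        (1 : Matrix (Fin m) (Fin m) ℝ)))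
    (h𝓜 : 𝓜 = (1 : Matrix (Fin 4) (Fin 4) ℝ) ⊗ₖ M)
    (h𝓚 : 𝓚 = η • ((1 : Matrix (Fin 4) (Fin 4) ℝ) ⊗ₖ K))
    (h𝓑 : 𝓑 = 𝓜 + G * 𝓚)
    (hT : Tα = (α • (1 : Matrix (Fin 4 × Fin m) (Fin 4 × Fin m) ℝ) + 𝓚)⁻¹ *
        (α • (1 : Matrix (Fin 4 × Fin m) (Fin 4 × Fin m) ℝ) + G * 𝓜) *
        (α • (1 : Matrix (Fin 4 × Fin m) (Fin 4 × Fin m) ℝ) + 𝓜)⁻¹ *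
        (α • (1 : Matrix (Fin 4 × Fin m) (Fin 4 × Fin m) ℝ) - G * 𝓚))
    (h𝓟 : 𝓟α = α⁻¹ •
        (((2 : ℝ)⁻¹ • ((1 : Matrix (Fin 4 × Fin m) (Fin 4 × Fin m) ℝ) - G)) *
          (α • (1 : Matrix (Fin 4 × Fin m) (Fin 4 × Fin m) ℝ) + 𝓜) * G *
          (α • (1 : Matrix (Fin 4 × Fin m) (Fin 4 × Fin m) ℝ) + 𝓚))) :
    IsUnit 𝓟α ∧ 𝓟α⁻¹ * 𝓑 = (1 : Matrix (Fin 4 × Fin m) (Fin 4 × Fin m) ℝ) - Tα := by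
  have hη0 : 0 < η := by rw [hη]; positivity
  have hGG : G * G = -1 := by
    rw [hG]
    apply kronecker_skew_mul_self
    rw [div_pow, Real.sq_sqrt (by positivity), Real.sq_sqrt hν.le]
    field_simp
    ring
  have hGM : 𝓜 * G = G * 𝓜 := by
    simp [hG, h𝓜, ← mul_kronecker_mul]
  have hA : IsUnit (α • (1 : Matrix (Fin 4 × Fin m) (Fin 4 × Fin m) ℝ) + 𝓜) := by
    simpa [h𝓜] using hM.isUnit_smul_one_add_smul_kronecker (l := Fin 4) hα one_pos
  have hC : IsUnit (α • (1 : Matrix (Fin 4 × Fin m) (Fin 4 × Fin m) ℝ) + 𝓚) := by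
    rw [h𝓚]
    exact hK.isUnit_smul_one_add_smul_kronecker hα hη0
  rw [h𝓟, h𝓑, hT]
  exact isUnit_and_inv_mul_eq_one_sub_of_mul_self_eq_neg_one hα.ne' hGM hGG hA hC
end
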